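/- arXiv:1711.10715 — 4 statements merged into one kernel-verified Lean document; each statement's English description precedes it below -/
import Mathlib

section
/- Let α ∈ (0,1], M > 0 and B > 0 with B ≤ M, and let 0 < k < α/B. Then for every s ∈ ℝ with −B ≤ s ≤ B, the associated weight function satisfies |α + (k/2)·s − W(s)| ≤ B²·k²/(2α). -/
/-- The weight function `W_{M}` from the paper: given damping `α`, time-step size `k`,
and threshold `M`, `W(s) = α + (k/2)·min{s,M}` for `s ≥ 0`, and
`W(s) = α / (1 + (k/(2α))·min{−s,M})` for `s < 0`. -/
noncomputable def weightFn (α k M : ℝ) (s : ℝ) : ℝ :=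
  if 0 ≤ s then α + k / 2 * min s M
  else α / (1 + k / (2 * α) * min (-s) M)

/-- Lemma 5.2(ii): if `0 < B ≤ M` and `0 < k < α/B`, then
`|α + (k/2)·s − W(s)| ≤ B²·k²/(2α)` for all `s ∈ [−B, B]`. -/
theorem weightFn_taylor_bound (α k M B : ℝ) (hα : α ∈ Set.Ioc (0 : ℝ) 1)
    (hM : 0 < M) (hB : 0 < B) (hBM : B ≤ M) (hk0 : 0 < k) (hk : k < α / B)
    (s : ℝ) (hs : -B ≤ s) (hs' : s ≤ B) :
    |α + k / 2 * s - weightFn α k M s| ≤ B ^ 2 * k ^ 2 / (2 * α) := by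
  obtain ⟨hα0, -⟩ := hα
  rcases le_or_gt 0 s with h | h
  · rw [weightFn, if_pos h, min_eq_left (hs'.trans hBM), sub_self, abs_zero]
    positivity
  · rw [weightFn, if_neg h.not_ge, min_eq_left (by linarith : -s ≤ M)]
    have hx : 0 ≤ k / (2 * α) * -s := mul_nonneg (by positivity) (by linarith)
    obtain ⟨x, hxs⟩ : ∃ x, x = k / (2 * α) * -s := ⟨_, rfl⟩
    have hlin : k / 2 * s = -(α * x) := by rw [hxs]; field_simp
    rw [← hxs] at hx ⊢
    have hdiff : α + k / 2 * s - α / (1 + x) = -(α * x ^ 2 / (1 + x)) := by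
      rw [hlin]; field_simp; ring
    have hs2 : s ^ 2 ≤ B ^ 2 := sq_le_sq' hs hs'
    rw [hdiff, abs_neg, abs_of_nonneg (by positivity)]
    calc α * x ^ 2 / (1 + x) ≤ α * x ^ 2 := div_le_self (by positivity) (by linarith)
      _ = s ^ 2 * k ^ 2 / (4 * α) := by rw [hxs]; field_simp; ring
      _ ≤ B ^ 2 * k ^ 2 / (2 * α) := by gcongr; norm_num
end

section
/- Let E be a real inner product space and let m : ℝ → E be three times continuously differentiable with ‖m(t)‖ = 1 for all t ∈ ℝ. Fix t ∈ ℝ and, for each real step size k, set v_k := m'(t) + (k/2)·(m''(t) − ⟪m''(t), m(t)⟫·m(t)). Then the map k ↦ ‖m(t) + k·v_k‖⁻¹·(m(t) + k·v_k) − m(t + k) is O(k³) as k → 0. -/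
open Topology Asymptotics RealInnerProductSpace

open Filter

section

variable {E : Type*} [NormedAddCommGroup E] [NormedSpace ℝ E]

/-- Second-order Taylor expansion, with a remainder of order three, of a curve of class `C³`. -/
lemma ContDiff.taylor_two_isBigO {f : ℝ → E} (hf : ContDiff ℝ 3 f) (t : ℝ) :
    (fun k : ℝ => f (t + k) - (f t + k • deriv f t + (k ^ 2 / 2) • deriv (deriv f) t))
      =O[𝓝 0] (fun k : ℝ => k ^ 3) := by
  have hshift : Tendsto (fun k : ℝ => t + k) (𝓝 0) (𝓝 t) :=
    (continuous_const_add t).tendsto' 0 t (add_zero t)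
  have hrem := ((taylor_isLittleO_univ (x₀ := t) (n := 3) hf).comp_tendsto hshift).isBigO
  have hcube : (fun k : ℝ => (k ^ 3 / 6) • iteratedDeriv 3 f t) =O[𝓝 0] (fun k : ℝ => k ^ 3) := by
    refine IsBigO.of_bound (‖iteratedDeriv 3 f t‖ / 6) (Eventually.of_forall fun k => ?_)
    rw [norm_smul, norm_div, Real.norm_of_nonneg (by norm_num : (0 : ℝ) ≤ 6)]
    exact le_of_eq (by ring)
  simp only [Function.comp_def, add_sub_cancel_left] at hrem
  refine (hrem.add hcube).congr_left fun k => ?_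
  simp only [taylor_within_apply, Finset.sum_range_succ, Finset.sum_range_zero,
    iteratedDerivWithin_univ, iteratedDeriv_zero, iteratedDeriv_one,
    iteratedDeriv_succ (n := 1), add_sub_cancel_left, Nat.factorial]
  norm_num
  module

/-- Normalizing a vector `w` of norm at least `1 / 2` that is close to a nonnegative multiple
of a unit vector `u` gives a vector close to `u`. -/
lemma norm_normalize_sub_le {w u : E} {c : ℝ} (hu : ‖u‖ = 1) (hc : 0 ≤ c) (hw : 1 / 2 ≤ ‖w‖) :
    ‖‖w‖⁻¹ • w - u‖ ≤ 4 * ‖w - c • u‖ := by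
  have hpos : 0 < ‖w‖ := by linarith
  have hcu : ‖c • u‖ = c := by rw [norm_smul, hu, mul_one, Real.norm_of_nonneg hc]
  have hdiff : ‖(c - ‖w‖) • u‖ ≤ ‖w - c • u‖ := by
    rw [norm_smul, hu, mul_one, Real.norm_eq_abs, abs_sub_comm]
    simpa only [hcu] using abs_norm_sub_norm_le w (c • u)
  have hinv : ‖w‖⁻¹ ≤ 2 := by
    simpa using inv_anti₀ (by norm_num) hw
  calc ‖‖w‖⁻¹ • w - u‖ = ‖‖w‖⁻¹ • ((w - c • u) + (c - ‖w‖) • u)‖ := by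
        congr 1
        rw [show (w - c • u) + (c - ‖w‖) • u = w - ‖w‖ • u by module, smul_sub,
          inv_smul_smul₀ hpos.ne']
    _ = ‖w‖⁻¹ * ‖(w - c • u) + (c - ‖w‖) • u‖ := by
        rw [norm_smul, norm_inv, norm_norm]
    _ ≤ 2 * (‖w - c • u‖ + ‖w - c • u‖) := by
        gcongr
        exact (norm_add_le _ _).trans (by gcongr)
    _ = 4 * ‖w - c • u‖ := by ring

end

/-- Lemma 4.1: for a smooth unit-length curve `m`, with
`v_k = m'(t) + (k/2)·P_{m(t)}(m''(t))` (the projection of `m''(t)` onto the tangent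
space at `m(t)`), the normalized update `(m(t) + k·v_k)/‖m(t) + k·v_k‖` approximates
`m(t+k)` up to `O(k³)`. -/
theorem tangent_plane_update_order_three {E : Type*} [NormedAddCommGroup E]
    [InnerProductSpace ℝ E] (m : ℝ → E) (hm : ContDiff ℝ 3 m)
    (hunit : ∀ t, ‖m t‖ = 1) (t : ℝ) :
    (fun k : ℝ =>
        ‖m t + k • (deriv m t + (k / 2) •
            (deriv (deriv m) t - ⟪deriv (deriv m) t, m t⟫ • m t))‖⁻¹ •
          (m t + k • (deriv m t + (k / 2) •
            (deriv (deriv m) t - ⟪deriv (deriv m) t, m t⟫ • m t)))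
        - m (t + k)) =O[𝓝 0] (fun k : ℝ => k ^ 3) := by
  set p : ℝ := ⟪deriv (deriv m) t, m t⟫
  set w : ℝ → E := fun k =>
    m t + k • (deriv m t + (k / 2) • (deriv (deriv m) t - p • m t)) with hw_def
  have hw_cont : Continuous w := by fun_prop
  have hw_norm : ∀ᶠ k in 𝓝 (0 : ℝ), 1 / 2 ≤ ‖w k‖ := by
    refine hw_cont.norm.continuousAt.eventually_const_le ?_
    simp only [hw_def, zero_smul, add_zero, hunit]
    norm_num
  have hc_nonneg : ∀ᶠ k in 𝓝 (0 : ℝ), 0 ≤ 1 - k ^ 2 / 2 * p := by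
    have hc_cont : Continuous fun k : ℝ => 1 - k ^ 2 / 2 * p := by fun_prop
    exact hc_cont.continuousAt.eventually_const_le (by norm_num)
  have hlin : (fun k : ℝ => m (t + k) - m t) =O[𝓝 0] (fun k : ℝ => k) := by
    have hd := ((hm.differentiable (by norm_num)) t).hasDerivAt
    have hO := hd.isBigO_sub.comp_tendsto
      ((continuous_const_add t).tendsto' 0 t (add_zero t))
    simpa only [Function.comp_def, add_sub_cancel_left] using hO
  have hsq : (fun k : ℝ => k ^ 2 / 2 * p) =O[𝓝 0] (fun k : ℝ => k ^ 2) :=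
    ((isBigO_refl (fun k : ℝ => k ^ 2) (𝓝 0)).const_mul_left (p / 2)).congr_left fun k => by ring
  have hcorr : (fun k : ℝ => (k ^ 2 / 2 * p) • (m (t + k) - m t)) =O[𝓝 0]
      (fun k : ℝ => k ^ 3) :=
    (hsq.smul hlin).congr_right fun k => by rw [smul_eq_mul]; ring
  have hw_approx : (fun k : ℝ => w k - (1 - k ^ 2 / 2 * p) • m (t + k)) =O[𝓝 0]
      (fun k : ℝ => k ^ 3) :=
    (hcorr.sub (hm.taylor_two_isBigO t)).congr_left fun k => by
      simp only [hw_def]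
      module
  refine IsBigO.trans (IsBigO.of_bound 4 ?_) hw_approx
  filter_upwards [hw_norm, hc_nonneg] with k hk hc
  exact norm_normalize_sub_le (hunit _) hc hk
end

section
/- Let E be a real inner product space, let m, v ∈ E with ‖m‖ = 1 and ⟪m, v⟫ = 0, and let k ≥ 0. Then ‖m + k·v‖ ≥ 1 and ‖ (m + k·v)/‖m + k·v‖ − m ‖ ≤ k·‖v‖. -/
open RealInnerProductSpace

/-- The nodal estimate used for (5.11): if `‖m‖ = 1`, `⟪m, v⟫ = 0`, and `k ≥ 0`, then
`‖m + k·v‖ ≥ 1` and the normalized update satisfies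
`‖(m + k·v)/‖m + k·v‖ − m‖ ≤ k·‖v‖`. -/
theorem nodal_update_estimate {E : Type*} [NormedAddCommGroup E]
    [InnerProductSpace ℝ E] (m v : E) (hm : ‖m‖ = 1) (hmv : ⟪m, v⟫ = 0)
    (k : ℝ) (hk : 0 ≤ k) :
    1 ≤ ‖m + k • v‖ ∧ ‖‖m + k • v‖⁻¹ • (m + k • v) - m‖ ≤ k * ‖v‖ := by
  have hwm : ⟪m + k • v, m⟫ = 1 := by
    rw [inner_add_left, real_inner_smul_left, real_inner_comm, real_inner_self_eq_norm_sq,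
      real_inner_comm, hmv, hm]
    norm_num
  have hsq : ‖m + k • v‖ ^ 2 = 1 + (k * ‖v‖) ^ 2 := by
    rw [norm_add_sq_real, real_inner_smul_right, hmv, hm, norm_smul, Real.norm_of_nonneg hk]
    ring
  have hN : 1 ≤ ‖m + k • v‖ := by
    nlinarith [norm_nonneg (m + k • v), sq_nonneg (k * ‖v‖)]
  refine ⟨hN, (sq_le_sq₀ (norm_nonneg _) (by positivity)).1 ?_⟩
  rw [norm_sub_sq_real, real_inner_smul_left, hwm, norm_smul, norm_inv, norm_norm,
    inv_mul_cancel₀ (by positivity), hm]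
  have hinv : 1 - ‖m + k • v‖⁻¹ ≤ ‖m + k • v‖ - 1 := by
    have h : ‖m + k • v‖ * ‖m + k • v‖⁻¹ = 1 := mul_inv_cancel₀ (by positivity)
    nlinarith [sq_nonneg (‖m + k • v‖ - 1), inv_nonneg.2 (norm_nonneg (m + k • v)),
      inv_le_one_of_one_le₀ hN]
  nlinarith
end

section
/- Let E and F be real normed vector spaces, let π : E → F be a continuous linear map, let m : ℝ → E be three times continuously differentiable with ‖m(t)‖ = 1 for all t ∈ ℝ, where E is a real inner product space, and fix t ∈ ℝ. For each real step size k set v_k := m'(t) + (k/2)·(m''(t) − ⟪m''(t), m(t)⟫·m(t)). Then the map k ↦ k·π(v_k) − (π(m(t)) − π(m(t − k))) is O(k²) as k → 0. -/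
open Topology Asymptotics RealInnerProductSpace

/-- Second-order Taylor expansion of a `C²` curve, backward in time, with an `O(k²)` remainder. -/
theorem isBigO_taylor_two_backward {E : Type*} [NormedAddCommGroup E] [NormedSpace ℝ E]
    {m : ℝ → E} (hm : ContDiff ℝ 2 m) (t : ℝ) :
    (fun k : ℝ => m (t - k) - (m t - k • deriv m t + (k ^ 2 / 2) • deriv (deriv m) t))
      =O[𝓝 0] (fun k : ℝ => k ^ 2) := by
  have hlim : Filter.Tendsto (fun k : ℝ => t - k) (𝓝 0) (𝓝 t) := by
    have h : Continuous fun k : ℝ => t - k := by fun_prop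
    simpa using h.tendsto 0
  have h := (taylor_isLittleO_univ (n := 2) (x₀ := t) hm).isBigO.comp_tendsto hlim
  refine h.congr (fun k => ?_) (fun k => ?_)
  · simp only [Function.comp_apply, taylorWithinEval_succ, taylor_within_zero_eval,
      iteratedDerivWithin_univ, iteratedDeriv_succ, iteratedDeriv_zero]
    norm_num
    module
  · simp

/-- Step 2 of the proof of Proposition 4.3: for a continuous linear operator `π`,
a smooth unit-length curve `m`, and `v_k = m'(t) + (k/2)·P_{m(t)}(m''(t))`, one has
`k·π(v_k) = π(m(t)) − π(m(t−k)) + O(k²)` as `k → 0`. -/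
theorem adams_bashforth_lower_order_estimate {E F : Type*} [NormedAddCommGroup E]
    [InnerProductSpace ℝ E] [NormedAddCommGroup F] [NormedSpace ℝ F]
    (π : E →L[ℝ] F) (m : ℝ → E) (hm : ContDiff ℝ 3 m)
    (hunit : ∀ t, ‖m t‖ = 1) (t : ℝ) :
    (fun k : ℝ =>
        k • π (deriv m t + (k / 2) •
          (deriv (deriv m) t - ⟪deriv (deriv m) t, m t⟫ • m t))
        - (π (m t) - π (m (t - k)))) =O[𝓝 0] (fun k : ℝ => k ^ 2) := by
  set p := deriv (deriv m) t - ⟪deriv (deriv m) t, m t⟫ • m t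
  have hR := (π.isBigO_comp _ _).trans
    (isBigO_taylor_two_backward (hm.of_le (by norm_num)) t)
  have hC : (fun k : ℝ => k ^ 2 • π ((1 / 2 : ℝ) • (deriv (deriv m) t + p)))
      =O[𝓝 0] (fun k : ℝ => k ^ 2) := by
    simpa using (isBigO_refl (fun k : ℝ => k ^ 2) (𝓝 0)).smul
      (isBigO_const_const (π ((1 / 2 : ℝ) • (deriv (deriv m) t + p))) (one_ne_zero (α := ℝ)) (𝓝 0))
  refine (hR.add hC).congr_left fun k => ?_
  simp only [map_add, map_sub, map_smul]
  module
end
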